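/- Let (A,d) be an N-differential graded algebra (d^N = 0) and e a degree-one derivation on A, and let t be a formal parameter with t² = 0. Then e defines an infinitesimal deformation of (A,d) into the N-dga (A, d+te), i.e. (d+te)^N = 0 over k[t]/(t²), if and only if Σ_{k=0}^{N−1} ( Σ_{p ∈ Par(k, N−k+1)} (−1)^{w(p)} ) · d^{N−k−1}(e) ∘ d^{k} = 0, where Par(k,m) = { p ∈ ℕ^m : Σᵢ pᵢ = k } and w(p) = Σ_{i=1}^{m} (i−1)pᵢ. -/

import Mathlib

/-- `dIter d e j` is the `j`-th iterated graded commutator `d^{(j)}(e)` of the degree-one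
derivation `d` with the degree-one derivation `e`:  `dIter d e 0 = e` and
`d^{j+1}(e) = d ∘ d^{j}(e) − (−1)^{j+1} d^{j}(e) ∘ d` (since `d^{j}(e)` has degree `j+1`). -/
def dIter {K A : Type*} [Field K] [Ring A] [Algebra K A]
    (d e : Module.End K A) : ℕ → Module.End K A
  | 0 => e
  | j + 1 => d * dIter d e j - ((-1 : ℤ) ^ (j + 1)) • (dIter d e j * d)

/-- `Par(k, m)` from the paper: the tuples `p : Fin m → ℕ` with `∑ pᵢ = k`, and for each
such `p` the sign `(−1)^{w(p)}` with `w(p) = Σᵢ (i−1)pᵢ` (one-based), summed up. -/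
def parSignSum (k m : ℕ) : ℤ :=
  ∑ p ∈ Finset.Nat.antidiagonalTuple m k, (-1 : ℤ) ^ (∑ i : Fin m, (i : ℕ) * p i)

theorem parSignSum_succ (k m : ℕ) : parSignSum k (m+1) =
    ∑ x ∈ Finset.HasAntidiagonal.antidiagonal k, (-1:ℤ)^x.2 * parSignSum x.2 m := by
  have key : ∀ (n k : ℕ) (f : (Fin n → ℕ) → ℤ), ∑ p ∈ Finset.Nat.antidiagonalTuple n k, f p =
      ((List.Nat.antidiagonalTuple n k).map f).sum := fun n k f => rfl
  have key2 : ∀ (k : ℕ) (f : ℕ × ℕ → ℤ), ∑ p ∈ Finset.HasAntidiagonal.antidiagonal k, f p =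
      ((List.Nat.antidiagonal k).map f).sum := fun k f => rfl
  unfold parSignSum
  rw [key, key2, List.Nat.antidiagonalTuple, List.map_flatMap, List.flatMap_def, List.sum_flatten, List.map_map]
  congr 1
  apply List.map_congr_left
  intro x hx
  rw [Function.comp, List.map_map, ← key, Finset.mul_sum]
  apply Finset.sum_congr rfl
  intro p hp
  rw [Finset.Nat.mem_antidiagonalTuple] at hp
  simp only [Function.comp, Fin.sum_univ_succ, Fin.cons_zero, Fin.cons_succ, Fin.val_zero,
    Fin.val_succ, zero_mul, zero_add, add_mul, one_mul, Finset.sum_add_distrib, hp]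
  rw [pow_add, mul_comm]

theorem parSignSum_zero (m : ℕ) : parSignSum 0 m = 1 := by
  simp [parSignSum, Finset.Nat.antidiagonalTuple_zero_right]

theorem parSignSum_succ_zero (k : ℕ) : parSignSum (k+1) 0 = 0 := by
  simp [parSignSum]

theorem parSignSum_rec (k m : ℕ) : parSignSum (k+1) (m+1) =
    parSignSum k (m+1) + (-1)^(k+1) * parSignSum (k+1) m := by
  rw [parSignSum_succ, parSignSum_succ, Finset.Nat.sum_antidiagonal_succ]
  ring

theorem parSignSum_one (k : ℕ) : parSignSum k 1 = 1 := by
  induction k with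
  | zero => exact parSignSum_zero 1
  | succ k ih => rw [parSignSum_rec, ih, parSignSum_succ_zero]; simp

theorem parSignSum_rec' (k m : ℕ) : parSignSum (k+1) (m+1) =
    parSignSum (k+1) m + (-1)^m * parSignSum k (m+1) := by
  induction k generalizing m with
  | zero =>
    induction m with
    | zero => simp [parSignSum_one, parSignSum_zero, parSignSum_succ_zero]
    | succ m ih =>
      have h1 := parSignSum_rec 0 (m+1)
      have h2 := parSignSum_rec 0 m
      simp only [parSignSum_zero] at *
      rw [h1, ih, pow_succ]
      rw [ih] at h2
      linear_combination -h2
  | succ k ihk =>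
    induction m with
    | zero => simp [parSignSum_one, parSignSum_succ_zero]
    | succ m ih =>
      have h1 := parSignSum_rec (k+1) (m+1)
      have h2 := parSignSum_rec (k+1) m
      have h3 := parSignSum_rec k (m+1)
      have h4 := ihk (m+1)
      rw [h1]
      linear_combination (-1)^(k+1+1) * ih + h4 - h2 - (-1)^(m+1) * h3

theorem d_mul_dIter {K A : Type*} [Field K] [Ring A] [Algebra K A]
    (d e : Module.End K A) (j : ℕ) :
    d * dIter d e j = dIter d e (j+1) + ((-1 : ℤ) ^ (j + 1)) • (dIter d e j * d) := by
  simp [dIter]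

theorem main_sum {K A : Type*} [Field K] [Ring A] [Algebra K A]
    (d e : Module.End K A) (N : ℕ) :
    ((TrivSqZeroExt.inl d : DualNumber (Module.End K A))
        + DualNumber.eps * TrivSqZeroExt.inl e) ^ N = TrivSqZeroExt.inl (d^N) +
        TrivSqZeroExt.inr (∑ k ∈ Finset.range N,
          parSignSum k (N - k + 1) • (dIter d e (N - k - 1) * d ^ k)) := by
  induction N with
  | zero => simp
  | succ N ih =>
    have hS : ∑ k ∈ Finset.range (N+1),
          parSignSum k (N + 1 - k + 1) • (dIter d e (N + 1 - k - 1) * d ^ k)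
        = d * (∑ k ∈ Finset.range N,
          parSignSum k (N - k + 1) • (dIter d e (N - k - 1) * d ^ k)) + e * d ^ N := by
      have hL : d * (∑ k ∈ Finset.range N,
          parSignSum k (N - k + 1) • (dIter d e (N - k - 1) * d ^ k)) =
          ∑ k ∈ Finset.range N, parSignSum k (N - k + 1) • (dIter d e (N - k) * d ^ k)
          + ∑ k ∈ Finset.range N, (parSignSum k (N - k + 1) * (-1)^(N-k)) •
              (dIter d e (N - k - 1) * d ^ (k+1)) := by
        rw [Finset.mul_sum, ← Finset.sum_add_distrib]
        apply Finset.sum_congr rfl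
        intro k hk
        obtain ⟨j, rfl⟩ : ∃ j, N = k + j + 1 := ⟨N - k - 1, by simp at hk; omega⟩
        have e1 : k + j + 1 - k = j + 1 := by omega
        rw [e1, Nat.add_sub_cancel, mul_smul_comm, ← mul_assoc, d_mul_dIter, add_mul, smul_add,
          smul_mul_assoc, smul_smul, mul_assoc, ← pow_succ']
      have hE : ∑ k ∈ Finset.range N, parSignSum k (N - k + 1) • (dIter d e (N - k) * d ^ k)
          + e * d ^ N = ∑ k ∈ Finset.range (N+1),
            parSignSum k (N - k + 1) • (dIter d e (N - k) * d ^ k) := by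
        rw [Finset.sum_range_succ]
        simp [parSignSum_one, dIter]
      rw [hL, add_right_comm, hE, Finset.sum_range_succ', Finset.sum_range_succ' _ N,
        add_right_comm, ← Finset.sum_add_distrib]
      congr 1
      · apply Finset.sum_congr rfl
        intro k hk
        obtain ⟨j, rfl⟩ : ∃ j, N = k + j + 1 := ⟨N - k - 1, by simp at hk; omega⟩
        have e1 : k + j + 1 - k = j + 1 := by omega
        have e2 : k + j + 1 + 1 - (k + 1) = j + 1 := by omega
        have e3 : k + j + 1 - (k + 1) = j := by omega
        rw [e1, e2, e3, Nat.add_sub_cancel, ← add_smul, parSignSum_rec' k (j+1)]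
        congr 1
        ring
      · simp [parSignSum_zero]
    rw [pow_succ', ih, hS]
    ext
    · simp [pow_succ']
    · simp [pow_succ']


/-- Let `(A,d)` be an `N`-dga (`d^N = 0`), `e` a degree-one derivation on
`A`, and `t` a formal parameter with `t² = 0`.  Then `e` defines an infinitesimal
deformation of `(A,d)` into the `N`-dga `(A, d+te)`, i.e. `(d+te)^N = 0` over `k[t]/(t²)`,
if and only if
`Σ_{k=0}^{N−1} ( Σ_{p ∈ Par(k, N−k+1)} (−1)^{w(p)} ) · d^{N−k−1}(e) ∘ d^k = 0`. -/
theorem infinitesimal_deformation_iff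
    {K A : Type*} [Field K] [Ring A] [Algebra K A]
    (𝒜 : ℤ → Submodule K A) [GradedAlgebra 𝒜]
    (d e : Module.End K A)
    (hd_deg : ∀ (i : ℤ), ∀ a ∈ 𝒜 i, d a ∈ 𝒜 (i + 1))
    (he_deg : ∀ (i : ℤ), ∀ a ∈ 𝒜 i, e a ∈ 𝒜 (i + 1))
    (hd_leib : ∀ (i : ℤ), ∀ a ∈ 𝒜 i, ∀ b : A,
      d (a * b) = d a * b + ((i.negOnePow : ℤ)) • (a * d b))
    (he_leib : ∀ (i : ℤ), ∀ a ∈ 𝒜 i, ∀ b : A,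
      e (a * b) = e a * b + ((i.negOnePow : ℤ)) • (a * e b))
    (N : ℕ) (hN : 1 ≤ N) (hdN : d ^ N = 0) :
    ((TrivSqZeroExt.inl d : DualNumber (Module.End K A))
        + DualNumber.eps * TrivSqZeroExt.inl e) ^ N = 0
      ↔ ∑ k ∈ Finset.range N,
          parSignSum k (N - k + 1) • (dIter d e (N - k - 1) * d ^ k) = 0 := by
  rw [main_sum, hdN, TrivSqZeroExt.inl_zero, zero_add]
  exact ⟨fun h => TrivSqZeroExt.inr_injective (h.trans (TrivSqZeroExt.inr_zero _).symm),
    fun h => by rw [h, TrivSqZeroExt.inr_zero]⟩
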